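/- Let 𝒬 be a sparse family of dyadic cubes arising from Lerner's formula and define, for i ≥ 1, 𝕊^{(i)}f := Σ_{Q ∈ 𝒟} χ_Q^{(i)} ⨍_Q f where χ_Q^{(i)} := Σ_{Q' ∈ 𝒬 : (Q')^{(i)} = Q} 1_{Q'}. Then for all 1 < p < ∞, ‖𝕊^{(i)}f‖_{L^p} ≲_{p,d} i ‖f‖_{L^p}. -/

import Mathlib

open MeasureTheory Set ENNReal

noncomputable section

/-- A dyadic cube in `ℝ^d`, given by a scale `k` and position `m`. -/
structure DC (d : ℕ) where
  k : ℤ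
  m : Fin d → ℤ

namespace DC

variable {d : ℕ}

/-- The underlying set of a dyadic cube. -/
def set (Q : DC d) : Set (Fin d → ℝ) :=
  {x | ∀ i, (Q.m i : ℝ) * 2 ^ Q.k ≤ x i ∧ x i < ((Q.m i : ℝ) + 1) * 2 ^ Q.k}

/-- The side length of a dyadic cube. -/
def side (Q : DC d) : ℝ := 2 ^ Q.k

/-- The dyadic parent. -/
def parent (Q : DC d) : DC d := ⟨Q.k + 1, fun i => Int.fdiv (Q.m i) 2⟩

/-- The `i`-th dyadic ancestor. -/
def anc (Q : DC d) : ℕ → DC d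
  | 0 => Q
  | (i + 1) => (Q.anc i).parent

end DC

/-- An axis-parallel cube with corner `c` and side length `h`. -/
def cube {d : ℕ} (c : Fin d → ℝ) (h : ℝ) : Set (Fin d → ℝ) :=
  {x | ∀ i, c i ≤ x i ∧ x i ≤ c i + h}

/-- `χ_Q^{(i)} = Σ_{Q' ∈ 𝒬 : (Q')^{(i)} = Q} 1_{Q'}`. -/
def chi {d : ℕ} (𝒬 : Set (DC d)) (i : ℕ) (Q : DC d) (x : Fin d → ℝ) : ℝ≥0∞ :=
  ∑' Q' : {Q' : DC d // Q' ∈ 𝒬 ∧ DC.anc Q' i = Q}, (Q' : DC d).set.indicator (fun _ => 1) x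

/-- The positive dyadic shift `𝕊^{(i)} f = Σ_{Q ∈ 𝒟} χ_Q^{(i)} ⨍_Q f`. -/
def Si {d : ℕ} (𝒬 : Set (DC d)) (i : ℕ) (f : (Fin d → ℝ) → ℝ≥0∞) (x : Fin d → ℝ) : ℝ≥0∞ :=
  ∑' Q : DC d, chi 𝒬 i Q x * ((volume Q.set)⁻¹ * ∫⁻ y in Q.set, f y)

lemma aux_meas_sup {X ι : Type*} [MeasurableSpace X] (F : Finset ι) (g : ι → X → NNReal)
    (hg : ∀ c ∈ F, Measurable (g c)) : Measurable (F.sup g) :=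
  Finset.sup_induction (p := Measurable) measurable_const (fun _ h _ h' => h.sup h') hg

lemma aux_step (p a A : ℝ) (hp : 1 < p) (ha : 0 ≤ a) (hA : 0 ≤ A) :
    (a + A) ^ p ≤ p * (a * (a + A) ^ (p - 1)) + A ^ p := by
  rcases eq_or_lt_of_le (add_nonneg ha hA) with h | h
  · rw [← h, Real.zero_rpow (by linarith)]
    have : 0 ≤ A ^ p := Real.rpow_nonneg hA _
    have h2 : 0 ≤ (0:ℝ) ^ (p - 1) := Real.rpow_nonneg le_rfl _
    positivity
  · set S := a + A with hS
    have hu : -1 ≤ -(a / S) := by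
      rw [neg_le_neg_iff, div_le_one h]; linarith
    have hB := one_add_mul_self_le_rpow_one_add hu hp.le
    have e : 1 + -(a / S) = A / S := by field_simp; linarith
    rw [e, Real.div_rpow hA h.le, le_div_iff₀ (Real.rpow_pos_of_pos h _)] at hB
    have e2 : S ^ p = S ^ (p - 1) * S := by
      rw [Real.rpow_sub_one h.ne']; field_simp
    have e3 : (1 + p * -(a / S)) * S ^ p = S ^ p - p * (a * S ^ (p-1)) := by
      rw [e2]; field_simp; ring
    linarith

lemma aux_chain {ι : Type*} [DecidableEq ι] (p : ℝ) (hp : 1 < p) (k : ι → ℤ) (a : ι → ℝ)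
    (ha : ∀ c, 0 ≤ a c) (F : Finset ι) :
    (∑ c ∈ F, a c) ^ p ≤
      p * ∑ c ∈ F, a c * (∑ c' ∈ F with k c ≤ k c', a c') ^ (p - 1) := by
  induction F using Finset.induction_on_min_value k with
  | empty => simp [Real.zero_rpow (show p ≠ 0 by linarith)]
  | insert b s hb hmin ih =>
    rw [Finset.sum_insert hb, Finset.sum_insert hb]
    have h1 : (insert b s).filter (fun c' => k b ≤ k c') = insert b s := by
      apply Finset.filter_true_of_mem
      intro c hc
      rcases Finset.mem_insert.1 hc with rfl | hc
      · exact le_rfl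
      · exact hmin c hc
    rw [h1, Finset.sum_insert hb, mul_add]
    refine (aux_step p _ _ hp (ha b) (Finset.sum_nonneg fun c _ => ha c)).trans ?_
    refine add_le_add le_rfl (ih.trans ?_)
    refine mul_le_mul_of_nonneg_left ?_ (by linarith)
    refine Finset.sum_le_sum fun c _ => mul_le_mul_of_nonneg_left ?_ (ha c)
    refine Real.rpow_le_rpow (Finset.sum_nonneg fun c _ => ha c) ?_ (by linarith)
    refine Finset.sum_le_sum_of_subset_of_nonneg ?_ (fun c _ _ => ha c)
    exact Finset.filter_subset_filter _ (Finset.subset_insert _ _)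

lemma aux_chain_nn {ι : Type*} [DecidableEq ι] (p : ℝ) (hp : 1 < p) (k : ι → ℤ) (a : ι → NNReal)
    (F : Finset ι) :
    (∑ c ∈ F, (a c : ℝ≥0∞)) ^ p ≤
      ENNReal.ofReal p * ∑ c ∈ F, (a c : ℝ≥0∞) *
        (∑ c' ∈ F with k c ≤ k c', (a c' : ℝ≥0∞)) ^ (p - 1) := by
  have h := aux_chain p hp k (fun c => (a c : ℝ)) (fun c => (a c).coe_nonneg) F
  have h' := ENNReal.ofReal_le_ofReal h
  have hs : ∀ G : Finset ι, ENNReal.ofReal (∑ c ∈ G, (a c : ℝ)) = ∑ c ∈ G, (a c : ℝ≥0∞) := by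
    intro G
    rw [ENNReal.ofReal_sum_of_nonneg (fun c _ => (a c).coe_nonneg)]
    simp
  have hn : ∀ G : Finset ι, 0 ≤ ∑ c ∈ G, (a c : ℝ) := fun G => Finset.sum_nonneg fun c _ => (a c).coe_nonneg
  rw [← ENNReal.ofReal_rpow_of_nonneg (hn _) (by linarith), hs,
    ENNReal.ofReal_mul (by linarith), ENNReal.ofReal_sum_of_nonneg] at h'
  · refine h'.trans_eq ?_
    congr 1
    refine Finset.sum_congr rfl fun c _ => ?_
    rw [ENNReal.ofReal_mul (a c).coe_nonneg, ← ENNReal.ofReal_rpow_of_nonneg (hn _) (by linarith), hs]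
    simp
  · intro c _
    exact mul_nonneg (a c).coe_nonneg (Real.rpow_nonneg (hn _) _)

lemma aux_sparse {X ι : Type*} [MeasurableSpace X] (μ : Measure X) (p : ℝ) (hp : 1 < p)
    (F : Finset ι) (Q E : ι → Set X) (k : ι → ℤ) (a : ι → NNReal) (M : X → ℝ≥0∞)
    (hQ : ∀ c, MeasurableSet (Q c)) (hE : ∀ c, MeasurableSet (E c))
    (hfin : ∀ c, μ (Q c) ≠ ⊤) (hEQ : ∀ c, E c ⊆ Q c)
    (hdis : Pairwise fun c c' => Disjoint (E c) (E c'))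
    (hsp : ∀ c, μ (Q c) ≤ 2 * μ (E c))
    (hnest : ∀ c c' x, x ∈ Q c → x ∈ Q c' → k c ≤ k c' → Q c ⊆ Q c')
    (hM : Measurable M) (haM : ∀ c ∈ F, ∀ x ∈ Q c, (a c : ℝ≥0∞) ≤ M x) :
    (∫⁻ x, (∑ c ∈ F, (Q c).indicator (fun _ => (a c : ℝ≥0∞)) x) ^ p ∂μ) ^ (1 / p) ≤
      2 * ENNReal.ofReal p * (∫⁻ x, M x ^ p ∂μ) ^ (1 / p) := by
  classical
  set s : X → ℝ≥0∞ := fun x => ∑ c ∈ F, (Q c).indicator (fun _ => (a c : ℝ≥0∞)) x with hs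
  have hsm : Measurable s :=
    Finset.measurable_sum _ fun c _ => measurable_const.indicator (hQ c)
  have hsx : ∀ x, s x = ∑ c ∈ F with x ∈ Q c, (a c : ℝ≥0∞) := by
    intro x
    rw [Finset.sum_filter]
    rfl
  set sQ : ι → ℝ≥0∞ := fun c => ∑ c' ∈ F with Q c ⊆ Q c', (a c' : ℝ≥0∞) with hsQ
  have hsQ_le : ∀ c, ∀ x ∈ Q c, sQ c ≤ s x := by
    intro c x hx
    rw [hsx]
    refine Finset.sum_le_sum_of_subset ?_
    intro c' hc'
    simp only [Finset.mem_filter] at hc' ⊢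
    exact ⟨hc'.1, hc'.2 hx⟩
  have hp0 : 0 < p := by linarith
  have hp1 : 0 < p - 1 := by linarith
  have hpt : ∀ x, s x ^ p ≤ ENNReal.ofReal p *
      ∑ c ∈ F, (Q c).indicator (fun _ => (a c : ℝ≥0∞) * sQ c ^ (p - 1)) x := by
    intro x
    rw [hsx]
    refine (aux_chain_nn p hp k a _).trans ?_
    gcongr
    rw [Finset.sum_filter]
    refine Finset.sum_le_sum fun c _ => ?_
    by_cases hx : x ∈ Q c
    · rw [if_pos hx, Set.indicator_of_mem hx]
      gcongr
      refine Finset.sum_le_sum_of_subset ?_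
      intro c' hc'
      simp only [Finset.mem_filter] at hc' ⊢
      exact ⟨hc'.1.1, hnest c c' x hx hc'.1.2 hc'.2⟩
    · rw [if_neg hx]; exact zero_le
  have hI : ∫⁻ x, s x ^ p ∂μ ≤ 2 * ENNReal.ofReal p * ∫⁻ x, M x * s x ^ (p - 1) ∂μ := by
    calc ∫⁻ x, s x ^ p ∂μ ≤ ∫⁻ x, ENNReal.ofReal p *
          ∑ c ∈ F, (Q c).indicator (fun _ => (a c : ℝ≥0∞) * sQ c ^ (p - 1)) x ∂μ :=
          lintegral_mono hpt
      _ = ENNReal.ofReal p * ∑ c ∈ F, (a c : ℝ≥0∞) * sQ c ^ (p - 1) * μ (Q c) := by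
          rw [lintegral_const_mul' _ _ ENNReal.ofReal_ne_top,
            lintegral_finsetSum _ (fun c _ => measurable_const.indicator (hQ c))]
          simp [lintegral_indicator, hQ]
      _ ≤ ENNReal.ofReal p * ∑ c ∈ F, 2 * ∫⁻ x in E c, M x * s x ^ (p - 1) ∂μ := by
          refine mul_le_mul_right (Finset.sum_le_sum fun c hc => ?_) _
          calc (a c : ℝ≥0∞) * sQ c ^ (p - 1) * μ (Q c)
              ≤ (a c : ℝ≥0∞) * sQ c ^ (p - 1) * (2 * μ (E c)) := by gcongr; exact hsp c
            _ = 2 * ∫⁻ x in E c, (a c : ℝ≥0∞) * sQ c ^ (p - 1) ∂μ := by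
                rw [setLIntegral_const]; ring
            _ ≤ 2 * ∫⁻ x in E c, M x * s x ^ (p - 1) ∂μ := by
                gcongr 2 * ?_
                refine setLIntegral_mono' (hE c) fun x hx => ?_
                gcongr
                · exact haM c hc x (hEQ c hx)
                · exact hsQ_le c x (hEQ c hx)
      _ = 2 * ENNReal.ofReal p * ∑ c ∈ F, ∫⁻ x in E c, M x * s x ^ (p - 1) ∂μ := by
          rw [← Finset.mul_sum]; ring
      _ = 2 * ENNReal.ofReal p * ∫⁻ x in ⋃ c ∈ F, E c, M x * s x ^ (p - 1) ∂μ := by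
          rw [lintegral_biUnion_finset (fun c _ c' _ h => hdis h) (fun c _ => hE c)]
      _ ≤ _ := by
          exact mul_le_mul_right (setLIntegral_le_lintegral _ _) _
  have hfinI : ∫⁻ x, s x ^ p ∂μ ≠ ⊤ := by
    have hle : ∀ x, s x ^ p ≤ (⋃ c ∈ F, Q c).indicator (fun _ => (∑ c ∈ F, (a c : ℝ≥0∞)) ^ p) x := by
      intro x
      by_cases hx : x ∈ ⋃ c ∈ F, Q c
      · rw [Set.indicator_of_mem hx, hsx]
        gcongr
        exact Finset.filter_subset _ _
      · rw [Set.indicator_of_notMem hx, hsx, Finset.filter_false_of_mem]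
        · simp [hp0]
        · intro c hc hxc
          exact hx (Set.mem_biUnion hc hxc)
    refine ((lintegral_mono hle).trans_lt ?_).ne
    rw [lintegral_indicator (Finset.measurableSet_biUnion _ fun c _ => hQ c), setLIntegral_const]
    refine ENNReal.mul_lt_top (ENNReal.rpow_lt_top_of_nonneg hp0.le ?_) ?_
    · simp
    · refine (measure_biUnion_finset_le _ _).trans_lt ?_
      exact ENNReal.sum_lt_top.2 fun c _ => (hfin c).lt_top
  have hH : ∫⁻ x, M x * s x ^ (p - 1) ∂μ ≤
      (∫⁻ x, M x ^ p ∂μ) ^ (1 / p) * (∫⁻ x, s x ^ p ∂μ) ^ (1 - 1 / p) := by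
    have hc : p.HolderConjugate (p / (p - 1)) := Real.HolderConjugate.conjExponent hp
    have := ENNReal.lintegral_mul_le_Lp_mul_Lq μ hc hM.aemeasurable
      ((hsm.pow_const (p - 1)).aemeasurable)
    refine this.trans_eq ?_
    congr 1
    have e1 : 1 / (p / (p - 1)) = 1 - 1 / p := by field_simp
    rw [e1]
    congr 2
    ext x
    rw [← ENNReal.rpow_mul]
    congr 1
    field_simp
  by_cases h0 : ∫⁻ x, s x ^ p ∂μ = 0
  · rw [h0, ENNReal.zero_rpow_of_pos (by positivity)]; exact zero_le
  set J := ∫⁻ x, s x ^ p ∂μ with hJ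
  have hJ1 : J = J ^ (1 / p) * J ^ (1 - 1 / p) := by
    rw [← ENNReal.rpow_add _ _ h0 hfinI]; simp
  have hpos : J ^ (1 - 1 / p) ≠ 0 := by
    simp [ENNReal.rpow_eq_zero_iff, h0, hfinI]
  have hnt : J ^ (1 - 1 / p) ≠ ⊤ := by
    simp [ENNReal.rpow_eq_top_iff, h0, hfinI]
  have : J ^ (1 / p) * J ^ (1 - 1 / p) ≤
      (2 * ENNReal.ofReal p * (∫⁻ x, M x ^ p ∂μ) ^ (1 / p)) * J ^ (1 - 1 / p) := by
    rw [← hJ1, mul_assoc _ _ (J ^ (1 - 1 / p))]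
    exact hI.trans (by gcongr)
  exact (ENNReal.mul_le_mul_iff_left hpos hnt).1 this

lemma aux_cover {X ι : Type*} [MeasurableSpace X] (μ ν : Measure X)
    (F : Finset ι) (Q : ι → Set X) (k : ι → ℤ) (hQ : ∀ c, MeasurableSet (Q c))
    (hnest : ∀ c c' x, x ∈ Q c → x ∈ Q c' → k c ≤ k c' → Q c ⊆ Q c') (t : ℝ≥0∞)
    (h : ∀ c ∈ F, t * μ (Q c) ≤ ν (Q c)) :
    t * μ (⋃ c ∈ F, Q c) ≤ ν (⋃ c ∈ F, Q c) := by
  classical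
  induction F using Finset.induction_on_min_value k with
  | empty => simp
  | insert b s hb hmin ih =>
    have ih' := ih fun c hc => h c (Finset.mem_insert_of_mem hc)
    rw [Finset.set_biUnion_insert]
    by_cases hd : Disjoint (Q b) (⋃ c ∈ s, Q c)
    · rw [measure_union' hd (hQ b), measure_union' hd (hQ b), mul_add]
      exact add_le_add (h b (Finset.mem_insert_self _ _)) ih'
    · rw [Set.not_disjoint_iff] at hd
      obtain ⟨x, hx, hx'⟩ := hd
      simp only [Set.mem_iUnion] at hx'
      obtain ⟨c, hc, hxc⟩ := hx'
      have hsub : Q b ⊆ ⋃ c ∈ s, Q c :=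
        (hnest b c x hx hxc (hmin c hc)).trans (Set.subset_biUnion_of_mem (u := Q) hc)
      rwa [Set.union_eq_self_of_subset_left hsub]

lemma aux_max {X ι : Type*} [MeasurableSpace X] (μ : Measure X) (p : ℝ) (hp : 1 < p)
    (F : Finset ι) (Q : ι → Set X) (k : ι → ℤ) (a : ι → NNReal) (f : X → NNReal)
    (hQ : ∀ c, MeasurableSet (Q c)) (hf : Measurable f) (hfin : ∀ c, μ (Q c) ≠ ⊤)
    (hnest : ∀ c c' x, x ∈ Q c → x ∈ Q c' → k c ≤ k c' → Q c ⊆ Q c')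
    (ha : ∀ c ∈ F, (a c : ℝ≥0∞) * μ (Q c) ≤ ∫⁻ x in Q c, f x ∂μ) :
    ∫⁻ x, ((F.sup fun c => (Q c).indicator (fun _ => a c) x : NNReal) : ℝ≥0∞) ^ p ∂μ ≤
      (ENNReal.ofReal p * (2 * ((ENNReal.ofReal (p - 1))⁻¹ * ENNReal.ofReal (2 ^ (p - 1))))) *
        ∫⁻ x, (f x : ℝ≥0∞) ^ p ∂μ := by
  classical
  have hp0 : 0 < p := by linarith
  have hp1 : 0 < p - 1 := by linarith
  set M : X → NNReal := fun x => F.sup fun c => (Q c).indicator (fun _ => a c) x with hMdef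
  have hMm : Measurable M := by
    have : M = F.sup fun c => (Q c).indicator (fun _ => a c) := by
      ext x; simp [hMdef, Finset.sup_apply]
    rw [this]
    exact aux_meas_sup _ _ fun c _ => measurable_const.indicator (hQ c)
  set ν := μ.withDensity (fun x => (f x : ℝ≥0∞)) with hν
  have hLM := lintegral_rpow_eq_lintegral_meas_lt_mul μ (f := fun x => (M x : ℝ))
    (Filter.Eventually.of_forall fun x => (M x).coe_nonneg) (by fun_prop) hp0
  have hLf := lintegral_rpow_eq_lintegral_meas_lt_mul ν (f := fun x => 2 * (f x : ℝ))
    (Filter.Eventually.of_forall fun x => by positivity) (by fun_prop) hp1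
  have hweak : ∀ t : ℝ, 0 < t → ENNReal.ofReal t * μ {x | t < (M x : ℝ)} ≤
      2 * ν {x | t < 2 * (f x : ℝ)} := by
    intro t ht
    set G := F.filter (fun c => t < (a c : ℝ)) with hG
    have hset : {x | t < (M x : ℝ)} ⊆ ⋃ c ∈ G, Q c := by
      intro x hx
      have hx' : t.toNNReal < F.sup fun c => (Q c).indicator (fun _ => a c) x :=
        (Real.toNNReal_lt_iff_lt_coe ht.le).2 hx
      rw [Finset.lt_sup_iff] at hx'
      obtain ⟨c, hc, hlt⟩ := hx'
      by_cases hxc : x ∈ Q c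
      · rw [Set.indicator_of_mem hxc] at hlt
        exact Set.mem_biUnion (show c ∈ G from Finset.mem_filter.2
          ⟨hc, (Real.toNNReal_lt_iff_lt_coe ht.le).1 hlt⟩) hxc
      · rw [Set.indicator_of_notMem hxc] at hlt
        exact absurd hlt not_lt_zero'
    set A := {x | t < 2 * (f x : ℝ)} with hA
    have hAm : MeasurableSet A := measurableSet_lt measurable_const (by fun_prop)
    have hcov := aux_cover μ (2 • ν.restrict A) G Q k hQ hnest (ENNReal.ofReal t) ?_
    · calc ENNReal.ofReal t * μ {x | t < (M x : ℝ)} ≤ ENNReal.ofReal t * μ (⋃ c ∈ G, Q c) := by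
            gcongr
        _ ≤ (2 • ν.restrict A) (⋃ c ∈ G, Q c) := hcov
        _ ≤ (2 • ν.restrict A) univ := measure_mono (subset_univ _)
        _ = 2 * ν A := by simp
    · intro c hc
      obtain ⟨hcF, hct⟩ := Finset.mem_filter.1 hc
      have h1 : ENNReal.ofReal t * μ (Q c) ≤ ∫⁻ x in Q c, f x ∂μ := by
        refine le_trans ?_ (ha c hcF)
        gcongr
        rw [← ENNReal.ofReal_coe_nnreal]
        exact ENNReal.ofReal_le_ofReal hct.le
      have h2 : ∫⁻ x in Q c, f x ∂μ ≤
          ∫⁻ x in Q c, (A.indicator (fun x => (f x : ℝ≥0∞)) x + ENNReal.ofReal (t / 2)) ∂μ := by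
        refine lintegral_mono fun x => ?_
        by_cases hx : x ∈ A
        · rw [Set.indicator_of_mem hx]; exact le_self_add
        · rw [Set.indicator_of_notMem hx, zero_add, ← ENNReal.ofReal_coe_nnreal]
          apply ENNReal.ofReal_le_ofReal
          simp only [hA, Set.mem_ofPred_eq, not_lt] at hx
          linarith
      rw [lintegral_add_right _ measurable_const, setLIntegral_const] at h2
      have h3 : ∫⁻ x in Q c, A.indicator (fun x => (f x : ℝ≥0∞)) x ∂μ = (ν.restrict A) (Q c) := by
        rw [lintegral_indicator hAm, Measure.restrict_restrict hAm,
          Measure.restrict_apply (hQ c), hν, withDensity_apply _ ((hQ c).inter hAm), Set.inter_comm]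
      rw [h3] at h2
      have h4 : ENNReal.ofReal t = ENNReal.ofReal (t / 2) + ENNReal.ofReal (t / 2) := by
        rw [← ENNReal.ofReal_add (by positivity) (by positivity)]; congr 1; ring
      have h5 := h1.trans h2
      have hnt : ENNReal.ofReal (t / 2) * μ (Q c) ≠ ⊤ :=
        ENNReal.mul_ne_top ENNReal.ofReal_ne_top (hfin c)
      rw [h4, add_mul] at h5
      have h6 := (ENNReal.add_le_add_iff_right hnt).1 h5
      rw [h4, add_mul]
      have e : (2 • ν.restrict A) (Q c) = (ν.restrict A) (Q c) + (ν.restrict A) (Q c) := by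
        simp [two_mul]
      rw [e]
      exact add_le_add h6 h6
  have hptw : ∀ t ∈ Ioi (0:ℝ), μ {x | t < (M x : ℝ)} * ENNReal.ofReal (t ^ (p - 1)) ≤
      2 * (ν {x | t < 2 * (f x : ℝ)} * ENNReal.ofReal (t ^ (p - 1 - 1))) := by
    intro t ht
    have ht0 : 0 < t := ht
    have e : t ^ (p - 1) = t * t ^ (p - 1 - 1) := by
      rw [Real.rpow_sub_one ht0.ne' (p - 1)]; field_simp
    rw [e, ENNReal.ofReal_mul ht0.le]
    calc _ = (ENNReal.ofReal t * μ {x | t < (M x : ℝ)}) * ENNReal.ofReal (t ^ (p - 1 - 1)) := by ring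
      _ ≤ (2 * ν {x | t < 2 * (f x : ℝ)}) * ENNReal.ofReal (t ^ (p - 1 - 1)) := by
          exact mul_le_mul_left (hweak t ht0) _
      _ = _ := by ring
  have e1 : ∫⁻ x, (M x : ℝ≥0∞) ^ p ∂μ = ∫⁻ x, ENNReal.ofReal ((M x : ℝ) ^ p) ∂μ := by
    refine lintegral_congr fun x => ?_
    rw [← ENNReal.ofReal_rpow_of_nonneg (M x).coe_nonneg hp0.le, ENNReal.ofReal_coe_nnreal]
  have e2 : ∫⁻ x, ENNReal.ofReal ((2 * (f x : ℝ)) ^ (p - 1)) ∂ν =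
      ENNReal.ofReal (2 ^ (p - 1)) * ∫⁻ x, (f x : ℝ≥0∞) ^ p ∂μ := by
    rw [hν, lintegral_withDensity_eq_lintegral_mul _ (by fun_prop) (by fun_prop),
      ← lintegral_const_mul' _ _ ENNReal.ofReal_ne_top]
    refine lintegral_congr fun x => ?_
    simp only [Pi.mul_apply]
    rw [Real.mul_rpow (by norm_num) (f x).coe_nonneg, ENNReal.ofReal_mul (by positivity),
      ← ENNReal.ofReal_rpow_of_nonneg (f x).coe_nonneg hp1.le, ENNReal.ofReal_coe_nnreal]
    have : (f x : ℝ≥0∞) ^ p = f x * (f x : ℝ≥0∞) ^ (p - 1) := by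
      conv_lhs => rw [show p = 1 + (p - 1) by ring]
      rw [ENNReal.rpow_add_of_nonneg _ _ (by norm_num) hp1.le, ENNReal.rpow_one]
    rw [this]; ring
  have hmono : ∫⁻ t in Ioi (0:ℝ), μ {x | t < (M x : ℝ)} * ENNReal.ofReal (t ^ (p - 1)) ≤
      2 * ∫⁻ t in Ioi (0:ℝ), ν {x | t < 2 * (f x : ℝ)} * ENNReal.ofReal (t ^ (p - 1 - 1)) := by
    rw [← lintegral_const_mul' _ _ (by simp)]
    exact setLIntegral_mono' measurableSet_Ioi hptw
  have e3 : ∫⁻ t in Ioi (0:ℝ), ν {x | t < 2 * (f x : ℝ)} * ENNReal.ofReal (t ^ (p - 1 - 1)) =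
      (ENNReal.ofReal (p - 1))⁻¹ * (ENNReal.ofReal (2 ^ (p - 1)) * ∫⁻ x, (f x : ℝ≥0∞) ^ p ∂μ) := by
    rw [← e2, hLf, ← mul_assoc, ENNReal.inv_mul_cancel, one_mul]
    · simpa using hp1
    · exact ENNReal.ofReal_ne_top
  rw [e1, hLM]
  calc _ ≤ _ := mul_le_mul_right hmono _
    _ = _ := by rw [e3]; ring

namespace DC
variable {d : ℕ}

lemma set_eq_pi (Q : DC d) : Q.set =
    Set.pi univ fun i => Ico ((Q.m i : ℝ) * 2 ^ Q.k) (((Q.m i : ℝ) + 1) * 2 ^ Q.k) := by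
  ext x; simp [DC.set]

lemma measurableSet_set (Q : DC d) : MeasurableSet Q.set := by
  rw [set_eq_pi]
  exact MeasurableSet.univ_pi fun i => measurableSet_Ico

lemma volume_ne_top (Q : DC d) : volume Q.set ≠ ⊤ := by
  rw [set_eq_pi, Real.volume_pi_Ico]
  exact ENNReal.prod_ne_top fun i _ => ENNReal.ofReal_ne_top

lemma nest (Q R : DC d) (x : Fin d → ℝ) (hQ : x ∈ Q.set) (hR : x ∈ R.set) (hk : Q.k ≤ R.k) :
    Q.set ⊆ R.set := by
  intro y hy i
  obtain ⟨n, hn⟩ := Int.eq_ofNat_of_zero_le (sub_nonneg.2 hk)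
  have hRk : (2:ℝ) ^ R.k = 2 ^ n * 2 ^ Q.k := by
    rw [show R.k = n + Q.k by omega, zpow_add₀ (by norm_num), zpow_natCast]
  have hpos : (0:ℝ) < 2 ^ Q.k := by positivity
  obtain ⟨q1, q2⟩ := hQ i
  obtain ⟨r1, r2⟩ := hR i
  obtain ⟨y1, y2⟩ := hy i
  rw [hRk, ← mul_assoc] at r1 r2 ⊢
  rw [← mul_assoc]
  have h1 := lt_of_mul_lt_mul_right (q1.trans_lt r2) hpos.le
  have h2 := lt_of_mul_lt_mul_right (r1.trans_lt q2) hpos.le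
  have h1' : Q.m i + 1 ≤ (R.m i + 1) * 2 ^ n := by
    have : Q.m i < (R.m i + 1) * 2 ^ n := by exact_mod_cast h1
    omega
  have h2' : R.m i * 2 ^ n ≤ Q.m i := by
    have : R.m i * 2 ^ n < Q.m i + 1 := by exact_mod_cast h2
    omega
  have h1r : (Q.m i : ℝ) + 1 ≤ (R.m i + 1) * 2 ^ n := by exact_mod_cast h1'
  have h2r : (R.m i : ℝ) * 2 ^ n ≤ Q.m i := by exact_mod_cast h2'
  exact ⟨(mul_le_mul_of_nonneg_right h2r hpos.le).trans y1,
    y2.trans_le (mul_le_mul_of_nonneg_right h1r hpos.le)⟩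

lemma subset_parent (Q : DC d) : Q.set ⊆ Q.parent.set := by
  intro x hx i
  obtain ⟨h1, h2⟩ := hx i
  have hk : (2:ℝ) ^ (Q.k + 1) = 2 * 2 ^ Q.k := by
    rw [zpow_add₀ (by norm_num)]; ring
  have hpos : (0:ℝ) < 2 ^ Q.k := by positivity
  simp only [parent]
  rw [hk, Int.fdiv_eq_ediv_of_nonneg _ (by norm_num), ← mul_assoc, ← mul_assoc]
  have a1 : (Q.m i / 2) * 2 ≤ Q.m i := by omega
  have a2 : Q.m i + 1 ≤ (Q.m i / 2 + 1) * 2 := by omega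
  have b1 : ((Q.m i / 2 : ℤ) : ℝ) * 2 ≤ Q.m i := by exact_mod_cast a1
  have b2 : (Q.m i : ℝ) + 1 ≤ (((Q.m i / 2 : ℤ) : ℝ) + 1) * 2 := by exact_mod_cast a2
  exact ⟨(mul_le_mul_of_nonneg_right b1 hpos.le).trans h1,
    h2.trans_le (mul_le_mul_of_nonneg_right b2 hpos.le)⟩

lemma subset_anc (Q : DC d) (i : ℕ) : Q.set ⊆ (Q.anc i).set := by
  induction i with
  | zero => exact subset_rfl
  | succ n ih => exact ih.trans (subset_parent _)

instance : Countable (DC d) := by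
  refine Function.Injective.countable (f := fun Q : DC d => (Q.k, Q.m)) ?_
  rintro ⟨k, m⟩ ⟨k', m'⟩ h
  simpa using h

end DC

lemma Si_eq {d : ℕ} (𝒬 : Set (DC d)) (i : ℕ) (f : (Fin d → ℝ) → ℝ≥0∞) (x : Fin d → ℝ) :
    Si 𝒬 i f x = ∑' Q : 𝒬, (Q : DC d).set.indicator
      (fun _ => (volume ((Q : DC d).anc i).set)⁻¹ * ∫⁻ y in ((Q : DC d).anc i).set, f y) x := by
  unfold Si chi
  let e : (Σ Q : DC d, {Q' : DC d // Q' ∈ 𝒬 ∧ DC.anc Q' i = Q}) ≃ 𝒬 :=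
    { toFun := fun s => ⟨s.2.1, s.2.2.1⟩
      invFun := fun Q => ⟨DC.anc Q i, ⟨Q, Q.2, rfl⟩⟩
      left_inv := by
        rintro ⟨Q, ⟨Q', h, rfl⟩⟩
        rfl
      right_inv := by
        rintro ⟨Q, h⟩
        rfl }
  rw [← e.tsum_eq, ENNReal.tsum_sigma']
  refine tsum_congr fun Q => ?_
  rw [← ENNReal.tsum_mul_right]
  refine tsum_congr fun Q' => ?_
  obtain ⟨Q', h, rfl⟩ := Q'
  simp only [e, Equiv.coe_fn_mk]
  by_cases hx : x ∈ Q'.set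
  · simp [hx]
  · simp [hx]

lemma aux_main {d : ℕ} (p : ℝ) (hp : 1 < p) (𝒬 : Set (DC d)) (E : 𝒬 → Set (Fin d → ℝ))
    (hE : ∀ c, MeasurableSet (E c)) (hEQ : ∀ c, E c ⊆ (c : DC d).set)
    (hdis : Pairwise fun c c' => Disjoint (E c) (E c'))
    (hsp : ∀ c : 𝒬, volume (c : DC d).set ≤ 2 * volume (E c)) (i : ℕ)
    (f : (Fin d → ℝ) → ℝ≥0∞) (hf : Measurable f) (hfin : ∫⁻ x, f x ^ p ≠ ⊤) :
    (∫⁻ x, Si 𝒬 i f x ^ p) ^ (1 / p) ≤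
      2 * ENNReal.ofReal p * ((ENNReal.ofReal p * (2 * ((ENNReal.ofReal (p - 1))⁻¹ *
        ENNReal.ofReal (2 ^ (p - 1))))) ^ (1 / p) * (∫⁻ x, f x ^ p) ^ (1 / p)) := by
  classical
  have hp0 : 0 < p := by linarith
  have hae : ∀ᵐ x, f x = ((f x).toNNReal : ℝ≥0∞) := by
    filter_upwards [ae_lt_top (hf.pow_const p) hfin] with x hx
    rw [ENNReal.coe_toNNReal]
    intro h
    rw [h, ENNReal.top_rpow_of_pos hp0] at hx
    exact lt_irrefl _ hx
  set avg : 𝒬 → ℝ≥0∞ := fun Q =>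
    (volume ((Q : DC d).anc i).set)⁻¹ * ∫⁻ y in ((Q : DC d).anc i).set, f y with havg
  have hint : ∀ R : DC d, ∫⁻ y in R.set, f y ≠ ⊤ := by
    intro R
    have h1 : ∀ y, f y ≤ 1 + f y ^ p := by
      intro y
      rcases le_total (f y) 1 with h | h
      · exact h.trans le_self_add
      · calc f y = f y ^ (1:ℝ) := by simp
          _ ≤ f y ^ p := ENNReal.rpow_le_rpow_of_exponent_le h hp.le
          _ ≤ _ := le_add_self
    refine ((lintegral_mono h1).trans_lt ?_).ne
    rw [lintegral_add_left measurable_const, setLIntegral_const, one_mul]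
    exact ENNReal.add_lt_top.2 ⟨R.volume_ne_top.lt_top,
      (setLIntegral_le_lintegral _ _).trans_lt hfin.lt_top⟩
  have havgt : ∀ Q, avg Q ≠ ⊤ := by
    intro Q
    by_cases h0 : volume ((Q : DC d).anc i).set = 0
    · simp only [havg]
      rw [setLIntegral_measure_zero _ _ h0]; simp
    · exact ENNReal.mul_ne_top (ENNReal.inv_ne_top.2 h0) (hint _)
  set a : 𝒬 → NNReal := fun Q => (avg Q).toNNReal with hadef
  have haavg : ∀ Q, (a Q : ℝ≥0∞) = avg Q := fun Q => ENNReal.coe_toNNReal (havgt Q)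
  have key : ∀ F : Finset 𝒬,
      (∫⁻ x, (∑ c ∈ F, (c : DC d).set.indicator (fun _ => avg c) x) ^ p) ^ (1 / p) ≤
      2 * ENNReal.ofReal p * ((ENNReal.ofReal p * (2 * ((ENNReal.ofReal (p - 1))⁻¹ *
        ENNReal.ofReal (2 ^ (p - 1))))) ^ (1 / p) * (∫⁻ x, f x ^ p) ^ (1 / p)) := by
    intro F
    have hmax := aux_max volume p hp F (fun c : 𝒬 => ((c : DC d).anc i).set)
      (fun c => ((c : DC d).anc i).k) a (fun x => (f x).toNNReal)
      (fun c => DC.measurableSet_set _) hf.ennreal_toNNReal (fun c => DC.volume_ne_top _)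
      (fun c c' x => DC.nest _ _ x) (by
        intro c _
        rw [haavg]
        have : ∫⁻ x in ((c : DC d).anc i).set, ((f x).toNNReal : ℝ≥0∞) =
            ∫⁻ x in ((c : DC d).anc i).set, f x :=
          lintegral_congr_ae (ae_restrict_of_ae (hae.mono fun x hx => hx.symm))
        rw [this]
        simp only [havg]
        calc _ = (volume ((c : DC d).anc i).set * (volume ((c : DC d).anc i).set)⁻¹) *
              ∫⁻ x in ((c : DC d).anc i).set, f x := by ring
          _ ≤ 1 * _ := by gcongr; exact ENNReal.mul_inv_le_one _
          _ = _ := one_mul _)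
    have hfe : ∫⁻ x, ((f x).toNNReal : ℝ≥0∞) ^ p = ∫⁻ x, f x ^ p :=
      lintegral_congr_ae (hae.mono fun x hx => by simp only [← hx])
    rw [hfe] at hmax
    set M : (Fin d → ℝ) → NNReal := fun x =>
      F.sup fun c : 𝒬 => ((c : DC d).anc i).set.indicator (fun _ => a c) x with hM
    have hMm : Measurable M := by
      have : M = F.sup fun c : 𝒬 => ((c : DC d).anc i).set.indicator (fun _ => a c) := by
        ext x; simp [hM, Finset.sup_apply]
      rw [this]
      exact aux_meas_sup _ _ fun c _ => measurable_const.indicator (DC.measurableSet_set _)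
    have hs := aux_sparse volume p hp F (fun c : 𝒬 => (c : DC d).set) E
      (fun c => (c : DC d).k) a (fun x => (M x : ℝ≥0∞)) (fun c => DC.measurableSet_set _) hE
      (fun c => DC.volume_ne_top _) hEQ hdis hsp (fun c c' x => DC.nest _ _ x) (by fun_prop) (by
        intro c hc x hx
        refine ENNReal.coe_le_coe.2 ?_
        have := Finset.le_sup (f := fun c : 𝒬 => ((c : DC d).anc i).set.indicator
          (fun _ => a c) x) hc
        simpa only [Set.indicator_of_mem (DC.subset_anc _ i hx)] using this)
    simp only [haavg] at hs
    refine hs.trans ?_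
    rw [← ENNReal.mul_rpow_of_nonneg _ _ (by positivity : (0:ℝ) ≤ 1 / p)]
    gcongr
  have hSi : ∀ x, Si 𝒬 i f x ^ p =
      ⨆ F : Finset 𝒬, (∑ c ∈ F, (c : DC d).set.indicator (fun _ => avg c) x) ^ p := by
    intro x
    rw [Si_eq, ENNReal.tsum_eq_iSup_sum]
    exact (ENNReal.orderIsoRpow p hp0).map_iSup _
  simp only [hSi]
  rw [lintegral_iSup_directed]
  · have : ∀ g : Finset 𝒬 → ℝ≥0∞, (⨆ F, g F) ^ (1 / p) = ⨆ F, g F ^ (1 / p) := fun g =>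
      (ENNReal.orderIsoRpow (1 / p) (by positivity)).map_iSup g
    rw [this]
    exact iSup_le key
  · intro F
    exact ((Finset.measurable_sum _ fun c _ =>
      measurable_const.indicator (DC.measurableSet_set _)).pow_const p).aemeasurable
  · refine Monotone.directed_le ?_
    intro F G hFG x
    dsimp only
    gcongr

/-- for the sparse family `𝒬` from Lerner's formula, the positive shift
`𝕊^{(i)}` satisfies the unweighted bound `‖𝕊^{(i)} f‖_{L^p} ≲_{p,d} i ‖f‖_{L^p}`. -/
theorem stmt15 {d : ℕ} (p : ℝ) (hp : 1 < p) :
    ∃ C : ℝ≥0∞, C ≠ ⊤ ∧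
      ∀ (Qf : ℕ → ℕ → DC d),
        (∀ k, Pairwise fun j j' => Disjoint (Qf k j).set (Qf k j').set) →
        (∀ k, (⋃ j, (Qf (k + 1) j).set) ⊆ ⋃ j, (Qf k j).set) →
        (∀ k j,
          volume ((Qf k j).set ∩ ⋃ j', (Qf (k + 1) j').set) ≤ volume (Qf k j).set / 2) →
        ∀ i : ℕ, 1 ≤ i →
        ∀ f : (Fin d → ℝ) → ℝ≥0∞, Measurable f →
          (∫⁻ x, Si {R | ∃ k j, Qf k j = R} i f x ^ p) ^ (1 / p)
            ≤ C * (i : ℝ≥0∞) * (∫⁻ x, f x ^ p) ^ (1 / p) := by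

  set K : ℝ≥0∞ := 2 * ENNReal.ofReal p * (ENNReal.ofReal p * (2 * ((ENNReal.ofReal (p - 1))⁻¹ *
        ENNReal.ofReal (2 ^ (p - 1))))) ^ (1 / p) with hK
  have hp0 : 0 < p := by linarith
  have hKt : K ≠ ⊤ := by
    refine ENNReal.mul_ne_top (ENNReal.mul_ne_top (by simp) ENNReal.ofReal_ne_top) ?_
    refine ENNReal.rpow_ne_top_of_nonneg (by positivity) ?_
    refine ENNReal.mul_ne_top ENNReal.ofReal_ne_top (ENNReal.mul_ne_top (by simp) ?_)
    refine ENNReal.mul_ne_top (ENNReal.inv_ne_top.2 ?_) ENNReal.ofReal_ne_top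
    simpa using hp
  refine ⟨K + 1, by simp [hKt], ?_⟩
  intro Qf hdisj hsub hsp i hi f hf
  have hi' : (1 : ℝ≥0∞) ≤ i := by exact_mod_cast hi
  by_cases hfin : ∫⁻ x, f x ^ p = ⊤
  · rw [hfin, ENNReal.top_rpow_of_pos (by positivity), ENNReal.mul_top]
    · exact le_top
    · refine mul_ne_zero (by simp) ?_
      intro h
      rw [h] at hi'
      simp at hi'
  set Ω : ℕ → Set (Fin d → ℝ) := fun k => ⋃ j, (Qf k j).set with hΩ
  have hanti : Antitone Ω := antitone_nat_of_succ_le hsub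
  set 𝒬 : Set (DC d) := {R | ∃ k j, Qf k j = R} with h𝒬
  choose kk jj hkj using fun c : 𝒬 => c.2
  have hΩm : ∀ k, MeasurableSet (Ω k) := fun k =>
    MeasurableSet.iUnion fun j => DC.measurableSet_set _
  have hlt : ∀ c c' : 𝒬, kk c < kk c' →
      Disjoint ((c : DC d).set \ Ω (kk c + 1)) ((c' : DC d).set \ Ω (kk c' + 1)) := by
    intro c c' h
    rw [Set.disjoint_left]
    rintro x ⟨_, hx⟩ ⟨hx', _⟩
    refine hx (hanti h ?_)
    rw [← hkj c'] at hx'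
    exact Set.mem_iUnion.2 ⟨_, hx'⟩
  have hmain := aux_main p hp 𝒬 (fun c => (c : DC d).set \ Ω (kk c + 1))
    (fun c => (DC.measurableSet_set _).diff (hΩm _)) (fun c => Set.sdiff_subset)
    (by
      intro c c' hne
      rcases lt_trichotomy (kk c) (kk c') with h | h | h
      · exact hlt c c' h
      · have hj : jj c ≠ jj c' := by
          intro hj
          apply hne
          apply Subtype.ext
          rw [← hkj c, ← hkj c', h, hj]
        have : Disjoint (Qf (kk c) (jj c)).set (Qf (kk c) (jj c')).set := hdisj (kk c) hj
        rw [hkj c, h, hkj c'] at this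
        exact this.mono Set.sdiff_subset Set.sdiff_subset
      · exact (hlt c' c h).symm)
    (by
      intro c
      have h := hsp (kk c) (jj c)
      rw [hkj c] at h
      have h2 := measure_inter_add_sdiff (μ := volume) (c : DC d).set (hΩm (kk c + 1))
      have hv := DC.volume_ne_top (c : DC d)
      have h3 : volume (c : DC d).set / 2 + volume (c : DC d).set / 2 ≤
          volume (c : DC d).set / 2 + volume ((c : DC d).set \ Ω (kk c + 1)) := by
        rw [ENNReal.add_halves]
        conv_lhs => rw [← h2]
        exact add_le_add h le_rfl
      have h4 := (ENNReal.add_le_add_iff_left (ENNReal.div_ne_top hv (by simp))).1 h3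
      rw [← ENNReal.add_halves (volume (c : DC d).set), two_mul]
      exact add_le_add h4 h4)
    i f hf hfin
  refine hmain.trans ?_
  rw [← mul_assoc, ← hK]
  gcongr
  calc K ≤ K + 1 := le_self_add
    _ = (K + 1) * 1 := (mul_one _).symm
    _ ≤ _ := by gcongr
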